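/- Let (X₁, μ₁) and (X₂, μ₂) be probability spaces, let g₁ : X₁ → ℝ and g₂ : X₂ → ℝ be measurable, and let M₁, M₂ : ℝ → ℝ be nonnegative integrable functions with compact support such that for i = 1, 2 and every bounded continuous Ψ : ℝ → ℂ one has (1/√(2π)) ∫_ℝ M_i(u) Ψ(u) du = ∫_{X_i} Ψ(g_i(x)) dμ_i(x). Define the convolution M(u) = (1/√(2π)) ∫_ℝ M₁(u′) M₂(u − u′) du′. Then M is nonnegative with compact support, and for every bounded continuous Ψ : ℝ → ℂ, (1/√(2π)) ∫_ℝ M(u) Ψ(u) du = ∫_{X₁} ∫_{X₂} Ψ(g₁(x₁) + g₂(x₂)) dμ₂(x₂) dμ₁(x₁). -/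

import Mathlib

open MeasureTheory Real

/-- Integrating a bounded continuous function against a convolution of integrable functions is a
double integral over sums of the variables. -/
theorem integral_convolution_mul_bounded {f g : ℝ → ℝ} (hf : Integrable f) (hg : Integrable g)
    {Ψ : ℝ → ℂ} (hΨ : Continuous Ψ) {C : ℝ} (hC : ∀ u, ‖Ψ u‖ ≤ C) :
    ∫ u : ℝ, ((∫ v : ℝ, f v * g (u - v) : ℝ) : ℂ) * Ψ u =
      ∫ v : ℝ, (f v : ℂ) * ∫ w : ℝ, (g w : ℂ) * Ψ (v + w) := by
  have hfg : Integrable (fun p : ℝ × ℝ => (f p.2 : ℂ) * (g (p.1 - p.2) : ℂ) * Ψ p.1)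
      (volume.prod volume) := by
    have h : Integrable (fun p : ℝ × ℝ => f p.2 * g (p.1 - p.2)) (volume.prod volume) :=
      hf.convolution_integrand (ContinuousLinearMap.mul ℝ ℝ) hg
    have h' := h.ofReal (𝕜 := ℂ)
    push_cast at h'
    exact h'.mul_bdd (c := C) (hΨ.comp continuous_fst).aestronglyMeasurable
      (Filter.Eventually.of_forall fun p => hC p.1)
  calc ∫ u : ℝ, ((∫ v : ℝ, f v * g (u - v) : ℝ) : ℂ) * Ψ u
      = ∫ u : ℝ, ∫ v : ℝ, (f v : ℂ) * (g (u - v) : ℂ) * Ψ u := by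
        simp_rw [integral_mul_const, ← Complex.ofReal_mul, integral_complex_ofReal]
    _ = ∫ v : ℝ, ∫ u : ℝ, (f v : ℂ) * (g (u - v) : ℂ) * Ψ u := integral_integral_swap hfg
    _ = ∫ v : ℝ, (f v : ℂ) * ∫ w : ℝ, (g w : ℂ) * Ψ (v + w) := by
        refine integral_congr_ae (Filter.Eventually.of_forall fun v => ?_)
        simp only [mul_assoc, integral_const_mul]
        rw [← integral_add_left_eq_self (fun u => (g (u - v) : ℂ) * Ψ u) v]
        simp only [add_sub_cancel_left]

/-- Convolution step: if `M₁, M₂` are nonnegative, integrable, compactly supported densities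
representing the distributions of `g₁ : X₁ → ℝ` and `g₂ : X₂ → ℝ` on probability spaces, then
their (normalized) convolution `M` is a nonnegative compactly supported density representing
the distribution of `g₁(x₁) + g₂(x₂)`. -/
theorem stmt_2 {X₁ X₂ : Type*} [MeasurableSpace X₁] [MeasurableSpace X₂]
    (μ₁ : Measure X₁) (μ₂ : Measure X₂)
    [IsProbabilityMeasure μ₁] [IsProbabilityMeasure μ₂]
    (g₁ : X₁ → ℝ) (g₂ : X₂ → ℝ) (hg₁ : Measurable g₁) (hg₂ : Measurable g₂)
    (M₁ M₂ : ℝ → ℝ)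
    (hM₁pos : ∀ u, 0 ≤ M₁ u) (hM₂pos : ∀ u, 0 ≤ M₂ u)
    (hM₁int : Integrable M₁) (hM₂int : Integrable M₂)
    (hM₁supp : HasCompactSupport M₁) (hM₂supp : HasCompactSupport M₂)
    (h₁ : ∀ Ψ : ℝ → ℂ, Continuous Ψ → (∃ C : ℝ, ∀ u, ‖Ψ u‖ ≤ C) →
      (1 / Real.sqrt (2 * Real.pi) : ℂ) * ∫ u : ℝ, (M₁ u : ℂ) * Ψ u =
        ∫ x, Ψ (g₁ x) ∂μ₁)
    (h₂ : ∀ Ψ : ℝ → ℂ, Continuous Ψ → (∃ C : ℝ, ∀ u, ‖Ψ u‖ ≤ C) →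
      (1 / Real.sqrt (2 * Real.pi) : ℂ) * ∫ u : ℝ, (M₂ u : ℂ) * Ψ u =
        ∫ x, Ψ (g₂ x) ∂μ₂)
    (M : ℝ → ℝ)
    (hM : ∀ u, M u = (1 / Real.sqrt (2 * Real.pi)) * ∫ u' : ℝ, M₁ u' * M₂ (u - u')) :
    (∀ u, 0 ≤ M u) ∧ HasCompactSupport M ∧
      ∀ Ψ : ℝ → ℂ, Continuous Ψ → (∃ C : ℝ, ∀ u, ‖Ψ u‖ ≤ C) →
        (1 / Real.sqrt (2 * Real.pi) : ℂ) * ∫ u : ℝ, (M u : ℂ) * Ψ u =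
          ∫ x₁, ∫ x₂, Ψ (g₁ x₁ + g₂ x₂) ∂μ₂ ∂μ₁ := by
  refine ⟨fun u => ?_, ?_, ?_⟩
  · rw [hM]
    exact mul_nonneg (by positivity)
      (integral_nonneg fun v => mul_nonneg (hM₁pos v) (hM₂pos (u - v)))
  · rw [funext hM]
    exact (hM₁supp.convolution (ContinuousLinearMap.mul ℝ ℝ) hM₂supp).mul_left
  · rintro Ψ hΨ ⟨C, hC⟩
    set F : ℝ → ℂ := fun v => ∫ x, Ψ (v + g₂ x) ∂μ₂ with hF
    have hFcont : Continuous F := by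
      refine continuous_of_dominated (bound := fun _ => C) (fun v => ?_)
        (fun v => Filter.Eventually.of_forall fun x => hC _) (integrable_const C)
        (Filter.Eventually.of_forall fun x => by fun_prop)
      exact (hΨ.measurable.comp (hg₂.const_add v)).aestronglyMeasurable
    have hFbdd : ∀ v, ‖F v‖ ≤ C := fun v => by
      simpa using norm_integral_le_of_norm_le_const (μ := μ₂)
        (Filter.Eventually.of_forall fun x => hC (v + g₂ x))
    have hFeq (v : ℝ) : F v = (1 / Real.sqrt (2 * Real.pi) : ℂ) *
        ∫ w : ℝ, (M₂ w : ℂ) * Ψ (v + w) :=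
      (h₂ (fun w => Ψ (v + w)) (by fun_prop) ⟨C, fun w => hC _⟩).symm
    rw [← h₁ F hFcont ⟨C, hFbdd⟩]
    simp only [hFeq, mul_left_comm _ (1 / Real.sqrt (2 * Real.pi) : ℂ), integral_const_mul]
    rw [← integral_convolution_mul_bounded hM₁int hM₂int hΨ hC]
    simp only [hM, Complex.ofReal_mul, Complex.ofReal_div, Complex.ofReal_one, mul_assoc,
      integral_const_mul]
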